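/- arXiv:1612.04974 — 3 statements merged into one kernel-verified Lean document; each statement's English description precedes it below -/
import Mathlib

section
/- Let (S, Y, H) be a plant with outputs, let Š = (X̌, X̌₀, Ǔ, ř) be an o-abstracted system, and suppose Ř(ε) ⊆ X × X̌ × U × Ǔ is a (κ',β',λ')-acSR from S to Š with a map ď : U × Ǔ → ℝ≥0, for some κ', λ' ∈ ℝ≥0 and β' ∈ [0,1). Let S̃ be the observer of S induced by Š. Then the family R'(ε) = {(x, x̃, u, ǔ) | ∃x̌ ∈ x̃ : (x, x̌, u, ǔ) ∈ Ř(ε)} is a (κ',β',λ')-acSR from S to S̃ with ď. -/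
/-- A (transition) system `S = (X, X₀, U, r)`: the type `X` is the set of states,
`init ⊆ X` the initial states, `U` the inputs, `tr` the transition map `r : X × U → 2^X`. -/
structure Sys (X U : Type*) where
  init : Set X
  tr : X → U → Set X

/-- Nonempty subsets of `X`, i.e. `2^X ∖ {∅}`. -/
abbrev NESet (X : Type*) := {s : Set X // s.Nonempty}

namespace Sys

variable {X U Y X₁ U₁ X₂ U₂ : Type*}

/-- `U(x) = {u ∈ U | r(x,u) ≠ ∅}`. -/
def enabled (S : Sys X U) (x : X) : Set U := {u | (S.tr x u).Nonempty}

/-- State projection `R_X` of a relation `R ⊆ X₁ × X₂ × U₁ × U₂`. -/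
def projX (R : Set (X₁ × X₂ × U₁ × U₂)) : Set (X₁ × X₂) :=
  {p | ∃ u₁ u₂, (p.1, p.2, u₁, u₂) ∈ R}

/-- `R(ε)` is a `κ`-approximate `(β, lam)`-contractive simulation relation from `S₁` to `S₂`
with `d`. -/
def IsAcSR (S₁ : Sys X₁ U₁) (S₂ : Sys X₂ U₂) (κ β lam : ℝ)
    (d : U₁ → U₂ → ℝ) (R : ℝ → Set (X₁ × X₂ × U₁ × U₂)) : Prop :=
  (∀ ε ε' : ℝ, κ ≤ ε → ε ≤ ε' → R ε ⊆ R ε') ∧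
  ∀ ε : ℝ, κ ≤ ε →
    (∀ x₁₀ ∈ S₁.init, ∃ x₂₀ ∈ S₂.init, (x₁₀, x₂₀) ∈ projX (R κ)) ∧
    (∀ x₁ x₂, (x₁, x₂) ∈ projX (R ε) → ∀ u₁ ∈ S₁.enabled x₁,
      ∃ u₂ ∈ S₂.enabled x₂, (x₁, x₂, u₁, u₂) ∈ R ε ∧
        ∀ x₁' ∈ S₁.tr x₁ u₁, ∃ x₂' ∈ S₂.tr x₂ u₂,
          (x₁', x₂') ∈ projX (R (κ + β * ε + lam * d u₁ u₂)))

/-- `R(ε)` is a `κ`-approximate `(β, lam)`-contractive alternating simulation relation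
from `S₁` to `S₂` with `d`. -/
def IsAcASR (S₁ : Sys X₁ U₁) (S₂ : Sys X₂ U₂) (κ β lam : ℝ)
    (d : U₁ → U₂ → ℝ) (R : ℝ → Set (X₁ × X₂ × U₁ × U₂)) : Prop :=
  (∀ ε ε' : ℝ, κ ≤ ε → ε ≤ ε' → R ε ⊆ R ε') ∧
  ∀ ε : ℝ, κ ≤ ε →
    (∀ x₁₀ ∈ S₁.init, ∃ x₂₀ ∈ S₂.init, (x₁₀, x₂₀) ∈ projX (R κ)) ∧
    (∀ x₁ x₂, (x₁, x₂) ∈ projX (R ε) → ∀ u₁ ∈ S₁.enabled x₁,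
      ∃ u₂ ∈ S₂.enabled x₂, (x₁, x₂, u₁, u₂) ∈ R ε ∧
        ∀ x₂' ∈ S₂.tr x₂ u₂, ∃ x₁' ∈ S₁.tr x₁ u₁,
          (x₁', x₂') ∈ projX (R (κ + β * ε + lam * d u₁ u₂)))

/-- An alternating simulation relation (ASR) is a `(0,0,0)`-acASR (a single relation). -/
def IsASR (S₁ : Sys X₁ U₁) (S₂ : Sys X₂ U₂) (R : Set (X₁ × X₂ × U₁ × U₂)) : Prop :=
  IsAcASR S₁ S₂ 0 0 0 (fun _ _ => 0) (fun _ => R)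

/-- Composition `S₁ ×_R S₂` with respect to an (exact) relation `R`. -/
def comp (S₁ : Sys X₁ U₁) (S₂ : Sys X₂ U₂) (R : Set (X₁ × X₂ × U₁ × U₂)) :
    Sys (X₁ × X₂) (U₁ × U₂) where
  init := (S₁.init ×ˢ S₂.init) ∩ projX R
  tr := fun x u => {x' | x'.1 ∈ S₁.tr x.1 u.1 ∧ x'.2 ∈ S₂.tr x.2 u.2 ∧
    (x.1, x.2, u.1, u.2) ∈ R ∧ (x'.1, x'.2) ∈ projX R}

/-- `e(x₁,x₂) := inf {ε ∈ ℝ≥0 | (x₁,x₂) ∈ R_X(ε)}`. -/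
noncomputable def errFn (R : ℝ → Set (X₁ × X₂ × U₁ × U₂)) (x₁ : X₁) (x₂ : X₂) : ℝ :=
  sInf {ε : ℝ | 0 ≤ ε ∧ (x₁, x₂) ∈ projX (R ε)}

/-- Approximate composition `S₁ ×_{R(ε)} S₂` with respect to a parameterized family `R(ε)`
(with parameters `κ, β, lam` and map `d`). -/
noncomputable def compAcc (S₁ : Sys X₁ U₁) (S₂ : Sys X₂ U₂) (κ β lam : ℝ)
    (d : U₁ → U₂ → ℝ) (R : ℝ → Set (X₁ × X₂ × U₁ × U₂)) :
    Sys (X₁ × X₂) (U₁ × U₂) where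
  init := (S₁.init ×ˢ S₂.init) ∩ projX (R κ)
  tr := fun x u => {x' | x'.1 ∈ S₁.tr x.1 u.1 ∧ x'.2 ∈ S₂.tr x.2 u.2 ∧
    (x.1, x.2, u.1, u.2) ∈ R (errFn R x.1 x.2) ∧
    (x'.1, x'.2) ∈ projX (R (κ + β * errFn R x.1 x.2 + lam * d u.1 u.2))}

/-- The powerset-lift system `𝐒` induced by `S`. -/
def powLift (S : Sys X U) : Sys (NESet X) U where
  init := {s | (s : Set X) ⊆ S.init}
  tr := fun bx u =>
    {bx' | (∀ x ∈ (bx : Set X), (S.tr x u).Nonempty) ∧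
      (bx' : Set X) ⊆ ⋃ x ∈ (bx : Set X), S.tr x u}

variable {Xo Uo : Type*}

/-- The observer `S̃` of the plant `S` induced by the o-abstracted system `So`,
given a `(κ', β', lam')`-acSR `Rc(ε)` from `S` to `So` with `dco`. -/
def observer (S : Sys X U) (So : Sys Xo Uo) (κ' β' lam' : ℝ)
    (dco : U → Uo → ℝ) (Rc : ℝ → Set (X × Xo × U × Uo)) : Sys (NESet Xo) Uo where
  init := {s | (s : Set Xo) ⊆ So.init}
  tr := fun xt uo => {xt' | ∀ xo' ∈ (xt' : Set Xo), ∃ xo ∈ (xt : Set Xo),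
    ∃ (x : X) (u : U), ∃ x' ∈ S.tr x u, ∃ ε : ℝ, κ' ≤ ε ∧
      xo' ∈ So.tr xo uo ∧ (x, xo, u, uo) ∈ Rc ε ∧
      (x', xo') ∈ projX (Rc (κ' + β' * ε + lam' * dco u uo))}

/-- The relation `R'(ε) = {(x, x̃, u, ǔ) | ∃ x̌ ∈ x̃ : (x, x̌, u, ǔ) ∈ Ř(ε)}` between the
plant and its observer. -/
def obsRel (Rc : ℝ → Set (X × Xo × U × Uo)) (ε : ℝ) : Set (X × NESet Xo × U × Uo) :=
  {q | ∃ xo ∈ (q.2.1 : Set Xo), (q.1, xo, q.2.2.1, q.2.2.2) ∈ Rc ε}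

end Sys

/-- Theorem 2 of the paper: given a plant with outputs `(S, Y, H)`, an
o-abstracted system `So` and a `(κ',β',lam')`-acSR `Rc(ε)` from `S` to `So` with `dco`,
the relation `R'(ε) = {(x, x̃, u, ǔ) | ∃ x̌ ∈ x̃ : (x, x̌, u, ǔ) ∈ Ř(ε)}` is a
`(κ',β',lam')`-acSR from `S` to the observer `S̃` induced by `So`, with `dco`. -/
theorem statement1
    {X U Y Xo Uo : Type*}
    (S : Sys X U) (H : X → Y) (So : Sys Xo Uo)
    (κ' lam' β' : ℝ) (hκ : 0 ≤ κ') (hlam : 0 ≤ lam') (hβ0 : 0 ≤ β') (hβ1 : β' < 1)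
    (dco : U → Uo → ℝ) (hd : ∀ u uo, 0 ≤ dco u uo)
    (Rc : ℝ → Set (X × Xo × U × Uo)) (hRc : Sys.IsAcSR S So κ' β' lam' dco Rc) :
    Sys.IsAcSR S (Sys.observer S So κ' β' lam' dco Rc) κ' β' lam' dco
      (Sys.obsRel Rc) := by
  obtain ⟨hmono, hsim⟩ := hRc
  refine ⟨fun ε ε' hε hle _ ⟨xo, hxo, hR⟩ => ⟨xo, hxo, hmono ε ε' hε hle hR⟩,
    fun ε hε => ⟨fun x₀ hx₀ => ?_, ?_⟩⟩
  · obtain ⟨xo, hxo, u, uo, hR⟩ := (hsim ε hε).1 x₀ hx₀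
    exact ⟨⟨{xo}, Set.singleton_nonempty xo⟩, Set.singleton_subset_iff.2 hxo, u, uo, xo, rfl, hR⟩
  · rintro x xt ⟨v, vo, xo, hxo, hR⟩ u hu
    obtain ⟨uo, -, hRu, hstep⟩ := (hsim ε hε).2 x xo ⟨v, vo, hR⟩ u hu
    have step : ∀ x' ∈ S.tr x u,
        ∃ xt' ∈ (Sys.observer S So κ' β' lam' dco Rc).tr xt uo,
          (x', xt') ∈ Sys.projX (Sys.obsRel Rc (κ' + β' * ε + lam' * dco u uo)) := by
      intro x' hx'
      obtain ⟨xo', hxo', w, wo, hR'⟩ := hstep x' hx'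
      refine ⟨⟨{xo'}, Set.singleton_nonempty xo'⟩, ?_, w, wo, xo', rfl, hR'⟩
      rintro _ rfl
      exact ⟨xo, hxo, x, u, x', hx', ε, hε, hxo', hRu, w, wo, hR'⟩
    obtain ⟨x', hx'⟩ := hu
    obtain ⟨xt', hxt', -⟩ := step x' hx'
    exact ⟨uo, ⟨xt', hxt'⟩, ⟨xo, hxo, hRu⟩, step⟩
end

section
/- Let A be the 2×2 real matrix with rows (0.5, 0) and (0, 0.25), let B = (3.6056, 3.9051)ᵀ ∈ ℝ², and let rd₂ : ℝ² → ℝ² round each coordinate to the nearest multiple of 0.01, i.e., rd₂(y)_i = round(100·y_i)/100 for i = 1, 2. Then for all ξ̂, ξ ∈ ℝ², all u ∈ ℝ, and all ε ≥ 0.005: if ‖ξ̂ − ξ‖_∞ ≤ ε, then ‖rd₂(A·ξ̂ + B·u) − (A·ξ + B·u)‖_∞ ≤ 0.005 + 0.5·ε and ‖rd₂(A·ξ̂) − A·ξ‖_∞ ≤ 0.005 + 0.5·ε. -/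
/-- Rounding to the nearest multiple of `1 / 100` moves a real number by at most `0.005`. -/
theorem abs_round_hundred_mul_div_sub_le (y : ℝ) :
    |(round (100 * y) : ℝ) / 100 - y| ≤ 0.005 := by
  have h := abs_le.mp (abs_sub_round (100 * y))
  rw [abs_le]
  constructor <;> linarith [h.1, h.2]

/-- Coordinatewise rounding to the grid `0.01·ℤⁿ` moves a vector by at most `0.005` in sup norm. -/
theorem norm_sub_le_of_eq_round {ι : Type*} [Fintype ι] {rd : (ι → ℝ) → (ι → ℝ)}
    (hrd : ∀ y i, rd y i = (round (100 * y i) : ℝ) / 100) (y : ι → ℝ) :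
    ‖rd y - y‖ ≤ 0.005 := by
  refine (pi_norm_le_iff_of_nonneg (by norm_num)).mpr fun i => ?_
  rw [Pi.sub_apply, hrd, Real.norm_eq_abs]
  exact abs_round_hundred_mul_div_sub_le (y i)

/-- The diagonal matrix with entries `0.5` and `0.25` contracts the sup norm by `0.5`. -/
theorem norm_diag_mulVec_le (x : Fin 2 → ℝ) :
    ‖(!![0.5, 0; 0, 0.25] : Matrix (Fin 2) (Fin 2) ℝ).mulVec x‖ ≤ 0.5 * ‖x‖ := by
  refine (pi_norm_le_iff_of_nonneg (by positivity)).mpr fun i => ?_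
  have hx : |x i| ≤ ‖x‖ := norm_le_pi_norm x i
  have hn := norm_nonneg x
  fin_cases i <;>
    simp only [Matrix.mulVec, dotProduct, Fin.sum_univ_two, Real.norm_eq_abs] <;>
    simp [abs_mul] at hx ⊢ <;> norm_num [abs_of_pos] <;> linarith

/-- the quantitative contraction estimate behind the claim that the relation
`R(ε)` (equal inputs, equal channel states, `‖ξ̂ − ξ‖_∞ ≤ ε`) is a `(0.005, 0.5, 0)`-acASR
from the c-abstracted system (rounding the updated state to the grid `0.01·ℤ²`) to the
plant `ξ[k+1] = A·ξ[k] + B·u[k]`.  Here `Fin 2 → ℝ` carries the sup norm `‖·‖_∞`. -/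
theorem statement8
    (A : Matrix (Fin 2) (Fin 2) ℝ) (hA : A = !![0.5, 0; 0, 0.25])
    (B : Fin 2 → ℝ) (hB : B = ![3.6056, 3.9051])
    (rd₂ : (Fin 2 → ℝ) → (Fin 2 → ℝ))
    (hrd : ∀ (y : Fin 2 → ℝ) (i : Fin 2), rd₂ y i = (round (100 * y i) : ℝ) / 100)
    (ξhat ξ : Fin 2 → ℝ) (u ε : ℝ) (hε : 0.005 ≤ ε)
    (h : ‖ξhat - ξ‖ ≤ ε) :
    ‖rd₂ (A.mulVec ξhat + u • B) - (A.mulVec ξ + u • B)‖ ≤ 0.005 + 0.5 * ε ∧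
    ‖rd₂ (A.mulVec ξhat) - A.mulVec ξ‖ ≤ 0.005 + 0.5 * ε := by
  subst hA
  have hc := norm_diag_mulVec_le (ξhat - ξ)
  rw [Matrix.mulVec_sub] at hc
  constructor
  · refine (norm_sub_le_norm_sub_add_norm_sub _ _ _).trans
      (add_le_add (norm_sub_le_of_eq_round hrd _) ?_)
    rw [add_sub_add_right_eq_sub]
    linarith
  · refine (norm_sub_le_norm_sub_add_norm_sub _ _ _).trans
      (add_le_add (norm_sub_le_of_eq_round hrd _) ?_)
    linarith
end

section
/- Let A be the 2×2 real matrix with rows (0.5, 0) and (0, 0.25), let B = (3.6056, 3.9051)ᵀ ∈ ℝ², and let rd₁ : ℝ² → ℝ² round each coordinate to the nearest multiple of 0.1, i.e., rd₁(y)_i = round(10·y_i)/10 for i = 1, 2. Then for all ξ, ξ̌ ∈ ℝ², all u ∈ ℝ, and all ε ≥ 0.05: if ‖ξ − ξ̌‖_∞ ≤ ε, then ‖(A·ξ + B·u) − rd₁(A·ξ̌ + B·u)‖_∞ ≤ 0.05 + 0.5·ε and ‖A·ξ − rd₁(A·ξ̌)‖_∞ ≤ 0.05 + 0.5·ε. 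-/
/-- Rounding a real number to the nearest multiple of `0.1` moves it by at most `0.05`. -/
theorem abs_sub_round_ten_mul_div_ten_le (x : ℝ) :
    |x - (round (10 * x) : ℝ) / 10| ≤ 0.05 := by
  have h := abs_le.mp (abs_sub_round (10 * x))
  rw [abs_le]
  constructor <;> linarith [h.1, h.2]

theorem norm_diagonal_mulVec_le (v : Fin 2 → ℝ) :
    ‖(!![0.5, 0; 0, 0.25] : Matrix (Fin 2) (Fin 2) ℝ).mulVec v‖ ≤ 0.5 * ‖v‖ := by
  refine (pi_norm_le_iff_of_nonneg (by positivity)).2 fun i => ?_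
  have hv := norm_le_pi_norm v i
  have hn := norm_nonneg v
  fin_cases i <;> simp [Matrix.mulVec, dotProduct, Fin.sum_univ_two] at hv ⊢ <;>
    norm_num [abs_of_pos] <;> linarith

/-- the quantitative contraction estimate behind the claim that the relation
`Ř(ε)` (equal inputs, equal channel states, `‖ξ − ξ̌‖_∞ ≤ ε`) is a `(0.05, 0.5, 0)`-acSR
from the plant `ξ[k+1] = A·ξ[k] + B·u[k]` to the o-abstracted system (rounding the updated
state to the grid `0.1·ℤ²`).  Here `Fin 2 → ℝ` carries the sup norm `‖·‖_∞`. -/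
theorem statement9
    (A : Matrix (Fin 2) (Fin 2) ℝ) (hA : A = !![0.5, 0; 0, 0.25])
    (B : Fin 2 → ℝ) (hB : B = ![3.6056, 3.9051])
    (rd₁ : (Fin 2 → ℝ) → (Fin 2 → ℝ))
    (hrd : ∀ (y : Fin 2 → ℝ) (i : Fin 2), rd₁ y i = (round (10 * y i) : ℝ) / 10)
    (ξ ξcheck : Fin 2 → ℝ) (u ε : ℝ) (hε : 0.05 ≤ ε)
    (h : ‖ξ - ξcheck‖ ≤ ε) :
    ‖(A.mulVec ξ + u • B) - rd₁ (A.mulVec ξcheck + u • B)‖ ≤ 0.05 + 0.5 * ε ∧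
    ‖A.mulVec ξ - rd₁ (A.mulVec ξcheck)‖ ≤ 0.05 + 0.5 * ε := by
  subst hA
  have hround : ∀ y, ‖y - rd₁ y‖ ≤ 0.05 := fun y =>
    (pi_norm_le_iff_of_nonneg (by norm_num)).2 fun i => by
      rw [Pi.sub_apply, hrd, Real.norm_eq_abs]
      exact abs_sub_round_ten_mul_div_ten_le (y i)
  have hstep : ∀ w : Fin 2 → ℝ,
      ‖(Matrix.mulVec !![0.5, 0; 0, 0.25] ξ + w) -
        rd₁ (Matrix.mulVec !![0.5, 0; 0, 0.25] ξcheck + w)‖ ≤ 0.05 + 0.5 * ε := fun w => by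
    have hcontr := norm_diagonal_mulVec_le (ξ - ξcheck)
    rw [Matrix.mulVec_sub, ← add_sub_add_right_eq_sub _ _ w] at hcontr
    refine (norm_sub_le_norm_sub_add_norm_sub _
      (Matrix.mulVec !![0.5, 0; 0, 0.25] ξcheck + w) _).trans ?_
    linarith [hround (Matrix.mulVec !![0.5, 0; 0, 0.25] ξcheck + w)]
  exact ⟨hstep (u • B), by simpa only [add_zero] using hstep 0⟩
end
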